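/- arXiv:2310.00956 — 15 statements merged into one kernel-verified Lean document; each statement's English description precedes it below -/
import Mathlib

section
/- Let (P, 𝒪) be a semitopology, let Val be a nonempty set (regarded with the discrete semitopology), let f : P → Val be a value assignment, let T ⊆ P be a transitive set, and let p, p' ∈ T. If f is continuous at p and continuous at p', then f(p) = f(p'). In particular, a value assignment that is continuous on a transitive set is constant on that set. -/
namespace Semitop

variable {P : Type*}

/-- A semitopology: a collection of open sets containing `∅` and `univ`,
closed under arbitrary unions. -/
def IsSemitop (𝒪 : Set (Set P)) : Prop :=
  ∅ ∈ 𝒪 ∧ Set.univ ∈ 𝒪 ∧ ∀ S ⊆ 𝒪, ⋃₀ S ∈ 𝒪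

/-- `T` is transitive: any two opens that intersect `T` intersect each other. -/
def IsTrans (𝒪 : Set (Set P)) (T : Set P) : Prop :=
  ∀ O ∈ 𝒪, ∀ O' ∈ 𝒪, (O ∩ T).Nonempty → (T ∩ O').Nonempty → (O ∩ O').Nonempty

/-- A topen is a nonempty transitive open set. -/
def IsTopen (𝒪 : Set (Set P)) (T : Set P) : Prop :=
  T.Nonempty ∧ IsTrans 𝒪 T ∧ T ∈ 𝒪

/-- A maximal topen: a topen contained in no strictly larger topen. -/
def MaxTopen (𝒪 : Set (Set P)) (S : Set P) : Prop :=
  IsTopen 𝒪 S ∧ ∀ S', IsTopen 𝒪 S' → S ⊆ S' → S' = S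

/-- `f` (into a discrete space of values) is continuous at `p`:
`f` is constant on some open neighbourhood of `p`. -/
def ContAt (𝒪 : Set (Set P)) {Val : Type*} (f : P → Val) (p : P) : Prop :=
  ∃ O ∈ 𝒪, p ∈ O ∧ ∀ q ∈ O, f q = f p

/-- `p` and `p'` are intertwined: every open neighbourhood of `p`
intersects every open neighbourhood of `p'`. -/
def Intw (𝒪 : Set (Set P)) (p p' : P) : Prop :=
  ∀ O ∈ 𝒪, ∀ O' ∈ 𝒪, p ∈ O → p' ∈ O' → (O ∩ O').Nonempty

/-- The set of points intertwined with `p`. -/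
def intwSet (𝒪 : Set (Set P)) (p : P) : Set P := {p' | Intw 𝒪 p p'}

/-- The interior of `R`: the union of all open subsets of `R`. -/
def sInterior (𝒪 : Set (Set P)) (R : Set P) : Set P := ⋃₀ {O | O ∈ 𝒪 ∧ O ⊆ R}

/-- The community of `p`: the interior of the set of points intertwined with `p`. -/
def community (𝒪 : Set (Set P)) (p : P) : Set P := sInterior 𝒪 (intwSet 𝒪 p)

/-- `p` is regular: `p ∈ community p` and `community p` is topen. -/
def Regular (𝒪 : Set (Set P)) (p : P) : Prop :=
  p ∈ community 𝒪 p ∧ IsTopen 𝒪 (community 𝒪 p)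

/-- `p` is weakly regular: `p ∈ community p`. -/
def WeaklyRegular (𝒪 : Set (Set P)) (p : P) : Prop := p ∈ community 𝒪 p

/-- Closure of a set: points all of whose open neighbourhoods intersect the set. -/
def sClosure (𝒪 : Set (Set P)) (S : Set P) : Set P :=
  {q | ∀ O ∈ 𝒪, q ∈ O → (O ∩ S).Nonempty}

/-- A set is closed when it equals its closure. -/
def IsClosedS (𝒪 : Set (Set P)) (C : Set P) : Prop := C = sClosure 𝒪 C

/-- `C` is a closed neighbourhood of `p`: closed with `p` in its interior. -/
def ClosedNbhdOf (𝒪 : Set (Set P)) (C : Set P) (p : P) : Prop :=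
  IsClosedS 𝒪 C ∧ p ∈ sInterior 𝒪 C

/-- `C` is a closed neighbourhood: closed with nonempty interior. -/
def ClosedNbhd (𝒪 : Set (Set P)) (C : Set P) : Prop :=
  IsClosedS 𝒪 C ∧ (sInterior 𝒪 C).Nonempty

/-- `p` is unconflicted: being intertwined is transitive through `p`. -/
def Unconflicted (𝒪 : Set (Set P)) (p : P) : Prop :=
  ∀ p' p'', Intw 𝒪 p' p → Intw 𝒪 p p'' → Intw 𝒪 p' p''

/-- `p` is strongly compatible: if `O'` and `O''` each intersect every
open neighbourhood of `p`, then `O'` intersects `O''`. -/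
def StrongCompat (𝒪 : Set (Set P)) (p : P) : Prop :=
  ∀ O' ∈ 𝒪, ∀ O'' ∈ 𝒪,
    (∀ O ∈ 𝒪, p ∈ O → (O' ∩ O).Nonempty ∧ (O ∩ O'').Nonempty) →
      (O' ∩ O'').Nonempty

/-- Two points of a transitive set at which `f` is continuous have the same value. -/
theorem IsTrans.eq_of_contAt {𝒪 : Set (Set P)} {T : Set P} (hT : IsTrans 𝒪 T)
    {Val : Type*} {f : P → Val} {p p' : P} (hp : p ∈ T) (hp' : p' ∈ T)
    (hf : ContAt 𝒪 f p) (hf' : ContAt 𝒪 f p') : f p = f p' := by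
  obtain ⟨O, hO, hpO, hfO⟩ := hf
  obtain ⟨O', hO', hpO', hfO'⟩ := hf'
  obtain ⟨q, hq, hq'⟩ := hT O hO O' hO' ⟨p, hpO, hp⟩ ⟨p', hp', hpO'⟩
  exact (hfO q hq).symm.trans (hfO' q hq')

theorem continuous_constant_on_transitive {P Val : Type*} [Nonempty Val]
    (𝒪 : Set (Set P)) (hST : IsSemitop 𝒪)
    (f : P → Val) (T : Set P) (hT : IsTrans 𝒪 T) :
    (∀ p ∈ T, ∀ p' ∈ T, ContAt 𝒪 f p → ContAt 𝒪 f p' → f p = f p') ∧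
    ((∀ p ∈ T, ContAt 𝒪 f p) → ∃ c : Val, ∀ p ∈ T, f p = c) := by
  refine ⟨fun p hp p' hp' hf hf' => hT.eq_of_contAt hp hp' hf hf', fun hf => ?_⟩
  obtain rfl | ⟨p₀, hp₀⟩ := T.eq_empty_or_nonempty
  · exact ⟨Classical.arbitrary Val, fun p hp => hp.elim⟩
  · exact ⟨f p₀, fun p hp => hT.eq_of_contAt hp hp₀ (hf p hp) (hf p₀ hp₀)⟩

end Semitop
end

section
/- Let (P, 𝒪) be a semitopology, let Val be a set with at least two elements (regarded with the discrete semitopology), and let T ⊆ P. If for every p, p' ∈ T and every value assignment f : P → Val, continuity of f at both p and p' implies f(p) = f(p'), then T is transitive. -/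
namespace Semitop

variable {P : Type*}

theorem transitive_of_no_split {P Val : Type*} [Nontrivial Val]
    (𝒪 : Set (Set P)) (hST : IsSemitop 𝒪) (T : Set P)
    (h : ∀ p ∈ T, ∀ p' ∈ T, ∀ f : P → Val,
      ContAt 𝒪 f p → ContAt 𝒪 f p' → f p = f p') :
    IsTrans 𝒪 T := by
  classical
  rintro O hO O' hO' ⟨p, hpO, hpT⟩ ⟨p', hp'T, hp'O'⟩
  by_contra hdisj
  have hnot : ∀ q ∈ O', q ∉ O := fun q hq' hq => hdisj ⟨q, hq, hq'⟩
  obtain ⟨a, b, hab⟩ := exists_pair_ne Val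
  let f : P → Val := fun q => if q ∈ O then a else b
  have hfO : ∀ q ∈ O, f q = a := fun q hq => if_pos hq
  have hfO' : ∀ q ∈ O', f q = b := fun q hq => if_neg (hnot q hq)
  have heq : f p = f p' := h p hpT p' hp'T f
    ⟨O, hO, hpO, fun q hq => (hfO q hq).trans (hfO p hpO).symm⟩
    ⟨O', hO', hp'O', fun q hq => (hfO' q hq).trans (hfO' p' hp'O').symm⟩
  exact hab ((hfO p hpO).symm.trans (heq.trans (hfO' p' hp'O')))

end Semitop
end

section
/- Let (P, 𝒪) be a semitopology and let T, T' ⊆ P be transitive sets with at least one of T and T' open. Then: (1) for all open sets O, O' ∈ 𝒪, if O ∩ T ≠ ∅, T ∩ T' ≠ ∅ and T' ∩ O' ≠ ∅, then O ∩ O' ≠ ∅; and (2) if T ∩ T' ≠ ∅ then T ∪ T' is transitive. -/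
namespace Semitop

variable {P : Type*}

/-- Opens meeting two overlapping transitive sets, one of which is open, intersect. -/
theorem IsTrans.inter_nonempty {𝒪 : Set (Set P)} {T T' O O' : Set P}
    (hT : IsTrans 𝒪 T) (hT' : IsTrans 𝒪 T') (hopen : T ∈ 𝒪 ∨ T' ∈ 𝒪)
    (hO : O ∈ 𝒪) (hO' : O' ∈ 𝒪) (hOT : (O ∩ T).Nonempty) (hTT' : (T ∩ T').Nonempty)
    (hTO' : (T' ∩ O').Nonempty) : (O ∩ O').Nonempty := by
  rcases hopen with h | h
  · exact hT O hO O' hO' hOT (hT' T h O' hO' hTT' hTO')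
  · exact hT' O hO O' hO' (hT O hO T' h hOT hTT') hTO'

theorem transitive_union {P : Type*}
    (𝒪 : Set (Set P)) (hST : IsSemitop 𝒪) (T T' : Set P)
    (hT : IsTrans 𝒪 T) (hT' : IsTrans 𝒪 T') (hopen : T ∈ 𝒪 ∨ T' ∈ 𝒪) :
    (∀ O ∈ 𝒪, ∀ O' ∈ 𝒪, (O ∩ T).Nonempty → (T ∩ T').Nonempty →
      (T' ∩ O').Nonempty → (O ∩ O').Nonempty) ∧
    ((T ∩ T').Nonempty → IsTrans 𝒪 (T ∪ T')) := by
  refine ⟨fun O hO O' hO' h₁ h₂ h₃ => hT.inter_nonempty hT' hopen hO hO' h₁ h₂ h₃, ?_⟩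
  intro hTT' O hO O' hO' h h'
  rw [Set.inter_union_distrib_left, Set.union_nonempty] at h
  rw [Set.union_inter_distrib_right, Set.union_nonempty] at h'
  rcases h with h | h <;> rcases h' with h' | h'
  · exact hT O hO O' hO' h h'
  · exact hT.inter_nonempty hT' hopen hO hO' h hTT' h'
  · exact hT'.inter_nonempty hT hopen.symm hO hO' h (Set.inter_comm T T' ▸ hTT') h'
  · exact hT' O hO O' hO' h h'

end Semitop
end

section
/- Let (P, 𝒪) be a semitopology and let 𝒯 be a nonempty family of topen sets whose elements pairwise intersect (T ∩ T' ≠ ∅ for all T, T' ∈ 𝒯). Then ⋃𝒯 is topen. -/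
namespace Semitop

variable {P : Type*}

theorem topen_sUnion_of_clique {P : Type*}
    (𝒪 : Set (Set P)) (hST : IsSemitop 𝒪) (𝒯 : Set (Set P))
    (hne : 𝒯.Nonempty) (htopen : ∀ T ∈ 𝒯, IsTopen 𝒪 T)
    (hpair : ∀ T ∈ 𝒯, ∀ T' ∈ 𝒯, (T ∩ T').Nonempty) :
    IsTopen 𝒪 (⋃₀ 𝒯) := by
  obtain ⟨T₀, hT₀⟩ := hne
  refine ⟨(htopen T₀ hT₀).1.mono (Set.subset_sUnion_of_mem hT₀), ?_,
    hST.2.2 𝒯 fun T hT => (htopen T hT).2.2⟩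
  rintro O hO O' hO' ⟨x, hxO, T, hT, hxT⟩ ⟨y, ⟨T', hT', hyT'⟩, hyO'⟩
  obtain ⟨-, hTtrans, -⟩ := htopen T hT
  obtain ⟨-, hT'trans, hT'open⟩ := htopen T' hT'
  exact hT'trans O hO O' hO' (hTtrans O hO T' hT'open ⟨x, hxO, hxT⟩ (hpair T hT T' hT'))
    ⟨y, hyT', hyO'⟩

end Semitop
end

section
/- Let (P, 𝒪) be a semitopology. Then every topen T is contained in a unique maximal topen; that is, there exists exactly one topen S with T ⊆ S such that S is not a proper subset of any topen. -/
namespace Semitop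

variable {P : Type*}

/-- The union of the topens containing a fixed nonempty set is transitive. -/
theorem isTrans_sUnion_topen_superset {P : Type*} {𝒪 : Set (Set P)} {T : Set P}
    (hT : T.Nonempty) : IsTrans 𝒪 (⋃₀ {U | IsTopen 𝒪 U ∧ T ⊆ U}) := by
  rintro O hO O' hO' ⟨p, hpO, U, ⟨hU, hTU⟩, hpU⟩ ⟨q, ⟨V, ⟨hV, hTV⟩, hqV⟩, hqO'⟩
  obtain ⟨t, ht⟩ := hT
  exact hV.2.1 O hO O' hO' (hU.2.1 O hO V hV.2.2 ⟨p, hpO, hpU⟩ ⟨t, hTU ht, hTV ht⟩)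
    ⟨q, hqV, hqO'⟩

theorem exists_unique_maximal_topen {P : Type*}
    (𝒪 : Set (Set P)) (hST : IsSemitop 𝒪) (T : Set P) (hT : IsTopen 𝒪 T) :
    ∃! S : Set P, T ⊆ S ∧ MaxTopen 𝒪 S := by
  have subset_union {S : Set P} (hS : IsTopen 𝒪 S) (hTS : T ⊆ S) :
      S ⊆ ⋃₀ {U | IsTopen 𝒪 U ∧ T ⊆ U} := fun _ hx => ⟨S, ⟨hS, hTS⟩, hx⟩
  have hTS := subset_union hT subset_rfl
  have hS : IsTopen 𝒪 (⋃₀ {U | IsTopen 𝒪 U ∧ T ⊆ U}) :=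
    ⟨hT.1.mono hTS, isTrans_sUnion_topen_superset hT.1, hST.2.2 _ fun _ hU => hU.1.2.2⟩
  refine ⟨_, ⟨hTS, hS, fun S' hS' hSS' => ?_⟩, fun S' ⟨hTS', hS', hmax⟩ => ?_⟩
  · exact (subset_union hS' (hTS.trans hSS')).antisymm hSS'
  · exact (hmax _ hS (subset_union hS' hTS')).symm

end Semitop
end

section
/- Let (P, 𝒪) be a semitopology and p ∈ P. Then the following are equivalent: (1) p is regular, i.e. p ∈ community(p) and community(p) is topen; (2) community(p) is a greatest topen neighbourhood of p (it is a topen containing p, and every topen containing p is a subset of it); (3) community(p) is a maximal topen and p ∈ community(p); (4) p has a maximal topen neighbourhood; (5) p has some topen neighbourhood. -/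
namespace Semitop

variable {P : Type*}

theorem community_mem {𝒪 : Set (Set P)} (hST : IsSemitop 𝒪) (p : P) :
    community 𝒪 p ∈ 𝒪 :=
  hST.2.2 _ fun _ hO => hO.1

theorem IsTopen.subset_community {𝒪 : Set (Set P)} {T : Set P} {p : P}
    (hT : IsTopen 𝒪 T) (hp : p ∈ T) : T ⊆ community 𝒪 p :=
  Set.subset_sUnion_of_mem ⟨hT.2.2, fun q hq O hO O' hO' hpO hqO' =>
    hT.2.1 O hO O' hO' ⟨p, hpO, hp⟩ ⟨q, hq, hqO'⟩⟩

theorem intw_of_mem_community {𝒪 : Set (Set P)} {p q : P} (hq : q ∈ community 𝒪 p) :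
    Intw 𝒪 p q := by
  obtain ⟨O, ⟨_, hO⟩, hqO⟩ := hq
  exact hO hqO

theorem IsTopen.isTopen_community {𝒪 : Set (Set P)} (hST : IsSemitop 𝒪) {T : Set P} {p : P}
    (hT : IsTopen 𝒪 T) (hp : p ∈ T) : IsTopen 𝒪 (community 𝒪 p) := by
  refine ⟨⟨p, hT.subset_community hp hp⟩, ?_, community_mem hST p⟩
  rintro O hO O' hO' ⟨a, haO, ha⟩ ⟨b, hb, hbO'⟩
  refine hT.2.1 O hO O' hO' ?_ (intw_of_mem_community hb T hT.2.2 O' hO' hp hbO')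
  rw [Set.inter_comm]
  exact intw_of_mem_community ha T hT.2.2 O hO hp haO

theorem regular_tfae {P : Type*}
    (𝒪 : Set (Set P)) (hST : IsSemitop 𝒪) (p : P) :
    List.TFAE [
      Regular 𝒪 p,
      IsTopen 𝒪 (community 𝒪 p) ∧ p ∈ community 𝒪 p ∧
        ∀ T, IsTopen 𝒪 T → p ∈ T → T ⊆ community 𝒪 p,
      MaxTopen 𝒪 (community 𝒪 p) ∧ p ∈ community 𝒪 p,
      ∃ T, p ∈ T ∧ MaxTopen 𝒪 T,
      ∃ T, p ∈ T ∧ IsTopen 𝒪 T ] := by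
  tfae_have 1 → 2 := fun h => ⟨h.2, h.1, fun _ hT hp => hT.subset_community hp⟩
  tfae_have 2 → 3 := fun ⟨ht, hp, hmax⟩ =>
    ⟨⟨ht, fun S hS hsub => (hmax S hS (hsub hp)).antisymm hsub⟩, hp⟩
  tfae_have 3 → 4 := fun h => ⟨_, h.2, h.1⟩
  tfae_have 4 → 5 := fun ⟨T, hp, hT⟩ => ⟨T, hp, hT.1⟩
  tfae_have 5 → 1 := fun ⟨_, hp, hT⟩ =>
    ⟨hT.subset_community hp hp, hT.isTopen_community hST hp⟩
  tfae_finish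

end Semitop
end

section
/- Let (P, 𝒪) be a semitopology and p ∈ P. Then p is regular if and only if p is weakly regular and community(p) = community(p') for every p' ∈ community(p). -/
namespace Semitop

variable {P : Type*}

theorem sInterior_subset (𝒪 : Set (Set P)) (R : Set P) : sInterior 𝒪 R ⊆ R :=
  Set.sUnion_subset fun _ hO => hO.2

theorem IsSemitop.sInterior_mem {𝒪 : Set (Set P)} (hST : IsSemitop 𝒪) (R : Set P) :
    sInterior 𝒪 R ∈ 𝒪 :=
  hST.2.2 _ fun _ hO => hO.1

/-- A point intertwined with one element of a topen is intertwined with all of them. -/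
theorem IsTopen.intwSet_subset {𝒪 : Set (Set P)} {T : Set P} (hT : IsTopen 𝒪 T) {a b : P}
    (ha : a ∈ T) (hb : b ∈ T) : intwSet 𝒪 a ⊆ intwSet 𝒪 b :=
  fun _ hq O hO O' hO' hbO hqO' =>
    hT.2.1 O hO O' hO' ⟨b, hbO, hb⟩ (hq T hT.2.2 O' hO' ha hqO')

theorem IsTopen.community_eq {𝒪 : Set (Set P)} {T : Set P} (hT : IsTopen 𝒪 T) {a b : P}
    (ha : a ∈ T) (hb : b ∈ T) : community 𝒪 a = community 𝒪 b :=
  congrArg (sInterior 𝒪) ((hT.intwSet_subset ha hb).antisymm (hT.intwSet_subset hb ha))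

theorem regular_iff_weaklyRegular_and_community_eq {P : Type*}
    (𝒪 : Set (Set P)) (hST : IsSemitop 𝒪) (p : P) :
    Regular 𝒪 p ↔
      (WeaklyRegular 𝒪 p ∧ ∀ p' ∈ community 𝒪 p, community 𝒪 p = community 𝒪 p') := by
  refine ⟨fun ⟨hp, hT⟩ => ⟨hp, fun p' hp' => hT.community_eq hp hp'⟩, fun ⟨hp, hC⟩ =>
    ⟨hp, ⟨p, hp⟩, ?_, hST.sInterior_mem _⟩⟩
  rintro O hO O' hO' ⟨a, haO, ha⟩ ⟨b, hb, hbO'⟩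
  rw [hC a ha] at hb
  exact sInterior_subset 𝒪 _ hb O hO O' hO' haO hbO'

end Semitop
end

section
/- Let X be a complete lattice and let ∗ be a binary relation on X that is commutative (x ∗ y ↔ y ∗ x), properly reflexive (x ≠ ⊥ implies x ∗ x), and completely distributive (x ∗ sSup S if and only if there exists y ∈ S with x ∗ y). Let x ∈ X with x ≠ ⊥, and let x^∗ = {y ∈ X | y ∗ x}. Then the following are equivalent: (1) x is transitive, i.e. for all y, z, if y ∗ x and x ∗ z then y ∗ z; (2) x^∗ is a completely prime semifilter; (3) x^∗ is a semifilter; (4) x^∗ is compatible; (5) x^∗ is a maximal semifilter. -/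
namespace Semiframe

variable {X : Type*} [CompleteLattice X]

/-- A set is compatible when its elements are pairwise compatible. -/
def Compat (ast : X → X → Prop) (F : Set X) : Prop := ∀ a ∈ F, ∀ b ∈ F, ast a b

/-- A set is up-closed. -/
def UpClosed (F : Set X) : Prop := ∀ a ∈ F, ∀ b, a ≤ b → b ∈ F

/-- A semifilter: nonempty, up-closed, compatible. -/
def Semifilter (ast : X → X → Prop) (F : Set X) : Prop :=
  F.Nonempty ∧ UpClosed F ∧ Compat ast F

/-- Completely prime: if a supremum is in `F` then some element of the family is. -/
def CompletelyPrime (F : Set X) : Prop := ∀ S : Set X, sSup S ∈ F → ∃ y ∈ S, y ∈ F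

/-- A maximal semifilter: contained in no strictly larger semifilter. -/
def MaxSemifilter (ast : X → X → Prop) (F : Set X) : Prop :=
  Semifilter ast F ∧ ∀ F', Semifilter ast F' → F ⊆ F' → F' = F

theorem ast_mono_right {ast : X → X → Prop}
    (hdist : ∀ (x : X) (S : Set X), ast x (sSup S) ↔ ∃ y ∈ S, ast x y)
    {x a b : X} (hab : a ≤ b) (h : ast x a) : ast x b := by
  have hsup : sSup {a, b} = b := by rw [sSup_pair, sup_eq_right.mpr hab]
  exact hsup ▸ (hdist x {a, b}).mpr ⟨a, Set.mem_insert a {b}, h⟩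

theorem upClosed_ast {ast : X → X → Prop}
    (hcomm : ∀ x y : X, ast x y ↔ ast y x)
    (hdist : ∀ (x : X) (S : Set X), ast x (sSup S) ↔ ∃ y ∈ S, ast x y)
    (x : X) : UpClosed {y | ast y x} := fun a ha b hab =>
  (hcomm x b).mp (ast_mono_right hdist hab ((hcomm a x).mp ha))

theorem completelyPrime_ast {ast : X → X → Prop}
    (hcomm : ∀ x y : X, ast x y ↔ ast y x)
    (hdist : ∀ (x : X) (S : Set X), ast x (sSup S) ↔ ∃ y ∈ S, ast x y)
    (x : X) : CompletelyPrime {y | ast y x} := by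
  intro S hS
  obtain ⟨y, hyS, hy⟩ := (hdist x S).mp ((hcomm _ x).mp hS)
  exact ⟨y, hyS, (hcomm x y).mp hy⟩

theorem Semifilter.maxSemifilter_ast {ast : X → X → Prop} {x : X} (hx : ast x x)
    (h : Semifilter ast {y | ast y x}) : MaxSemifilter ast {y | ast y x} :=
  ⟨h, fun _ hF hsub => Set.Subset.antisymm (fun y hy => hF.2.2 y hy x (hsub hx)) hsub⟩

theorem transitive_tfae (ast : X → X → Prop)
    (hcomm : ∀ x y : X, ast x y ↔ ast y x)
    (hrefl : ∀ x : X, x ≠ ⊥ → ast x x)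
    (hdist : ∀ (x : X) (S : Set X), ast x (sSup S) ↔ ∃ y ∈ S, ast x y)
    (x : X) (hx : x ≠ ⊥) :
    List.TFAE [
      ∀ y z : X, ast y x → ast x z → ast y z,
      Semifilter ast {y | ast y x} ∧ CompletelyPrime {y | ast y x},
      Semifilter ast {y | ast y x},
      Compat ast {y | ast y x},
      MaxSemifilter ast {y | ast y x} ] := by
  have hxx : ast x x := hrefl x hx
  tfae_have 1 → 4 := fun h a ha b hb => h a b ha ((hcomm b x).mp hb)
  tfae_have 4 → 1 := fun h y z hy hz => h y hy z ((hcomm x z).mp hz)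
  tfae_have 4 → 3 := fun h => ⟨⟨x, hxx⟩, upClosed_ast hcomm hdist x, h⟩
  tfae_have 3 → 2 := fun h => ⟨h, completelyPrime_ast hcomm hdist x⟩
  tfae_have 2 → 5 := fun h => h.1.maxSemifilter_ast hxx
  tfae_have 5 → 4 := fun h => h.1.2.2
  tfae_finish

end Semiframe
end

section
/- Let (P, 𝒪) be a semitopology, let p ∈ P be regular, and let O be a topen. Then O ∩ community(p) ≠ ∅ if and only if O ⊆ community(p). -/
namespace Semitop

variable {P : Type*}

theorem topen_inter_community_iff_subset {P : Type*}
    (𝒪 : Set (Set P)) (hST : IsSemitop 𝒪) (p : P) (hreg : Regular 𝒪 p)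
    (O : Set P) (hO : IsTopen 𝒪 O) :
    (O ∩ community 𝒪 p).Nonempty ↔ O ⊆ community 𝒪 p := by
  obtain ⟨hp, -, hTrans, hOpen⟩ := hreg
  refine ⟨fun h => ?_, fun h => ?_⟩
  · refine Set.subset_sUnion_of_mem ⟨hO.2.2, fun q hq U hU V hV hpU hqV => ?_⟩
    obtain ⟨x, hxV, hxC⟩ := hO.2.1 V hV _ hOpen ⟨q, hqV, hq⟩ h
    exact hTrans U hU V hV ⟨p, hpU, hp⟩ ⟨x, hxC, hxV⟩
  · rw [Set.inter_eq_left.mpr h]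
    exact hO.1

end Semitop
end

section
/- Let (P, 𝒪) be a semitopology and let p, p' ∈ P both be regular. Then community(p) ∩ community(p') ≠ ∅ if and only if community(p) = community(p'). -/
namespace Semitop

variable {P : Type*}

/-- The points intertwined with a point of a topen are those in the closure of the topen. -/
theorem IsTopen.intwSet_eq_sClosure {𝒪 : Set (Set P)} {T : Set P} {p : P}
    (hT : IsTopen 𝒪 T) (hp : p ∈ T) : intwSet 𝒪 p = sClosure 𝒪 T := by
  ext r
  constructor
  · intro h O hO hr
    rw [Set.inter_comm]
    exact h T hT.2.2 O hO hp hr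
  · intro h O hO O' hO' hpO hrO'
    refine hT.2.1 O hO O' hO' ⟨p, hpO, hp⟩ ?_
    rw [Set.inter_comm]
    exact h O' hO' hrO'

/-- If a topen meets an open set, its closure is contained in the closure of that set. -/
theorem IsTopen.sClosure_subset {𝒪 : Set (Set P)} {S T : Set P}
    (hT : IsTopen 𝒪 T) (hS : S ∈ 𝒪) (hTS : (T ∩ S).Nonempty) :
    sClosure 𝒪 T ⊆ sClosure 𝒪 S :=
  fun _ hr O hO hrO => hT.2.1 O hO S hS (hr O hO hrO) hTS

theorem community_inter_iff_eq {P : Type*}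
    (𝒪 : Set (Set P)) (hST : IsSemitop 𝒪) (p p' : P)
    (hp : Regular 𝒪 p) (hp' : Regular 𝒪 p') :
    (community 𝒪 p ∩ community 𝒪 p').Nonempty ↔ community 𝒪 p = community 𝒪 p' := by
  constructor
  · intro h
    have h' := h
    rw [Set.inter_comm] at h'
    have hcl : sClosure 𝒪 (community 𝒪 p) = sClosure 𝒪 (community 𝒪 p') :=
      (hp.2.sClosure_subset hp'.2.2.2 h).antisymm (hp'.2.sClosure_subset hp.2.2.2 h')
    rw [← hp.2.intwSet_eq_sClosure hp.1, ← hp'.2.intwSet_eq_sClosure hp'.1] at hcl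
    exact congrArg (sInterior 𝒪) hcl
  · intro h
    exact ⟨p, hp.1, h ▸ hp.1⟩

end Semitop
end

section
/- Let (P, 𝒪) be a semitopology and p, p' ∈ P. Then: (1) p ⋈ p' if and only if for every open O with p ∈ O we have p' ∈ closure(O); (2) intertwined(p) = ⋂{closure(O) | O ∈ 𝒪, p ∈ O}; (3) intertwined(p) equals the intersection of all closed neighbourhoods of p, i.e. of all closed sets C with p ∈ interior(C); and (4) intertwined(p) is a closed set. -/
namespace Semitop

variable {P : Type*}

theorem subset_sClosure (𝒪 : Set (Set P)) (S : Set P) : S ⊆ sClosure 𝒪 S :=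
  fun x hx _ _ hxO => ⟨x, hxO, hx⟩

theorem sClosure_mono (𝒪 : Set (Set P)) {S T : Set P} (h : S ⊆ T) :
    sClosure 𝒪 S ⊆ sClosure 𝒪 T :=
  fun _ hx O hO hxO => (hx O hO hxO).mono (Set.inter_subset_inter_right O h)

theorem isClosedS_sClosure (𝒪 : Set (Set P)) (S : Set P) : IsClosedS 𝒪 (sClosure 𝒪 S) := by
  refine (subset_sClosure 𝒪 _).antisymm fun x hx O hO hxO => ?_
  obtain ⟨y, hyO, hy⟩ := hx O hO hxO
  exact hy O hO hyO

theorem isClosedS_sInter (𝒪 : Set (Set P)) {𝒞 : Set (Set P)} (h : ∀ C ∈ 𝒞, IsClosedS 𝒪 C) :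
    IsClosedS 𝒪 (⋂₀ 𝒞) := by
  refine (subset_sClosure 𝒪 _).antisymm fun x hx C hC => ?_
  rw [h C hC]
  exact sClosure_mono 𝒪 (Set.sInter_subset_of_mem hC) hx

theorem intw_iff_forall_mem_sClosure (𝒪 : Set (Set P)) (p p' : P) :
    Intw 𝒪 p p' ↔ ∀ O ∈ 𝒪, p ∈ O → p' ∈ sClosure 𝒪 O := by
  constructor
  · intro h O hO hp O' hO' hp'
    rw [Set.inter_comm]
    exact h O hO O' hO' hp hp'
  · intro h O hO O' hO' hp hp'
    rw [Set.inter_comm]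
    exact h O hO hp O' hO' hp'

theorem intwSet_eq_sInter_sClosure (𝒪 : Set (Set P)) (p : P) :
    intwSet 𝒪 p = ⋂₀ {C : Set P | ∃ O ∈ 𝒪, p ∈ O ∧ C = sClosure 𝒪 O} := by
  ext x
  refine (intw_iff_forall_mem_sClosure 𝒪 p x).trans ⟨?_, ?_⟩
  · rintro h _ ⟨O, hO, hp, rfl⟩
    exact h O hO hp
  · exact fun h O hO hp => h _ ⟨O, hO, hp, rfl⟩

theorem intwSet_eq_sInter_closedNbhdOf (𝒪 : Set (Set P)) (p : P) :
    intwSet 𝒪 p = ⋂₀ {C : Set P | ClosedNbhdOf 𝒪 C p} := by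
  rw [intwSet_eq_sInter_sClosure]
  apply Set.Subset.antisymm
  · rintro x hx C ⟨hC, O, ⟨hO, hOC⟩, hp⟩
    rw [hC]
    exact sClosure_mono 𝒪 hOC (hx _ ⟨O, hO, hp, rfl⟩)
  · rintro x hx _ ⟨O, hO, hp, rfl⟩
    exact hx _ ⟨isClosedS_sClosure 𝒪 O, O, ⟨hO, subset_sClosure 𝒪 O⟩, hp⟩

theorem isClosedS_intwSet (𝒪 : Set (Set P)) (p : P) : IsClosedS 𝒪 (intwSet 𝒪 p) := by
  rw [intwSet_eq_sInter_closedNbhdOf]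
  exact isClosedS_sInter 𝒪 fun _ hC => hC.1

theorem intertwined_as_closure {P : Type*}
    (𝒪 : Set (Set P)) (hST : IsSemitop 𝒪) (p p' : P) :
    (Intw 𝒪 p p' ↔ ∀ O ∈ 𝒪, p ∈ O → p' ∈ sClosure 𝒪 O) ∧
    (intwSet 𝒪 p = ⋂₀ {C : Set P | ∃ O ∈ 𝒪, p ∈ O ∧ C = sClosure 𝒪 O}) ∧
    (intwSet 𝒪 p = ⋂₀ {C : Set P | ClosedNbhdOf 𝒪 C p}) ∧
    IsClosedS 𝒪 (intwSet 𝒪 p) :=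
  ⟨intw_iff_forall_mem_sClosure 𝒪 p p', intwSet_eq_sInter_sClosure 𝒪 p,
    intwSet_eq_sInter_closedNbhdOf 𝒪 p, isClosedS_intwSet 𝒪 p⟩

end Semitop
end

section
/- Let (P, 𝒪) be a semitopology and p ∈ P. Then the following are equivalent: (1) p is weakly regular, i.e. p ∈ community(p); (2) intertwined(p) is a closed neighbourhood of p; (3) the set of closed neighbourhoods of p, ordered by subset inclusion, has a least element; (4) intertwined(p) is least in the set of closed neighbourhoods of p ordered by subset inclusion. -/
namespace Semitop

variable {P : Type*}

theorem sInterior_mono (𝒪 : Set (Set P)) {S T : Set P} (h : S ⊆ T) :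
    sInterior 𝒪 S ⊆ sInterior 𝒪 T := by
  rintro q ⟨O, ⟨hO, hOS⟩, hqO⟩
  exact ⟨O, ⟨hO, hOS.trans h⟩, hqO⟩

theorem isClosedS_of_sClosure_subset {𝒪 : Set (Set P)} {S : Set P}
    (h : sClosure 𝒪 S ⊆ S) : IsClosedS 𝒪 S :=
  (subset_sClosure 𝒪 S).antisymm h

theorem intwSet_subset_sClosure {𝒪 : Set (Set P)} {p : P} {O : Set P} (hO : O ∈ 𝒪)
    (hp : p ∈ O) : intwSet 𝒪 p ⊆ sClosure 𝒪 O := by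
  intro q hq O' hO' hqO'
  rw [Set.inter_comm]
  exact hq O hO O' hO' hp hqO'

theorem ClosedNbhdOf.intwSet_subset {𝒪 : Set (Set P)} {p : P} {C : Set P}
    (hC : ClosedNbhdOf 𝒪 C p) : intwSet 𝒪 p ⊆ C := by
  obtain ⟨hclosed, O, ⟨hO, hOC⟩, hpO⟩ := hC
  rw [hclosed]
  exact (intwSet_subset_sClosure hO hpO).trans (sClosure_mono 𝒪 hOC)

theorem closedNbhdOf_sClosure {𝒪 : Set (Set P)} {p : P} {O : Set P} (hO : O ∈ 𝒪)
    (hp : p ∈ O) : ClosedNbhdOf 𝒪 (sClosure 𝒪 O) p :=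
  ⟨isClosedS_sClosure 𝒪 O, O, ⟨hO, subset_sClosure 𝒪 O⟩, hp⟩

theorem subset_intwSet_of_forall_closedNbhdOf {𝒪 : Set (Set P)} {p : P} {C : Set P}
    (h : ∀ C', ClosedNbhdOf 𝒪 C' p → C ⊆ C') : C ⊆ intwSet 𝒪 p := by
  intro q hq O hO O' hO' hpO hqO'
  rw [Set.inter_comm]
  exact h _ (closedNbhdOf_sClosure hO hpO) hq O' hO' hqO'

theorem weaklyRegular_tfae {P : Type*}
    (𝒪 : Set (Set P)) (hST : IsSemitop 𝒪) (p : P) :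
    List.TFAE [
      WeaklyRegular 𝒪 p,
      ClosedNbhdOf 𝒪 (intwSet 𝒪 p) p,
      ∃ C : Set P, ClosedNbhdOf 𝒪 C p ∧ ∀ C', ClosedNbhdOf 𝒪 C' p → C ⊆ C',
      ClosedNbhdOf 𝒪 (intwSet 𝒪 p) p ∧
        ∀ C', ClosedNbhdOf 𝒪 C' p → intwSet 𝒪 p ⊆ C' ] := by
  tfae_have 1 → 2 := fun h => ⟨isClosedS_intwSet 𝒪 p, h⟩
  tfae_have 2 → 4 := fun h => ⟨h, fun _ hC => hC.intwSet_subset⟩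
  tfae_have 4 → 3 := fun h => ⟨_, h⟩
  tfae_have 3 → 1 := fun ⟨_, hC, hleast⟩ =>
    sInterior_mono 𝒪 (subset_intwSet_of_forall_closedNbhdOf hleast) hC.2
  tfae_finish

end Semitop
end

section
/- Let (P, 𝒪) be a semitopology and p ∈ P. If p is weakly regular (p ∈ community(p)), then closure(community(p)) = intertwined(p). -/
namespace Semitop

variable {P : Type*}

theorem closure_community_eq_intertwined {P : Type*}
    (𝒪 : Set (Set P)) (hST : IsSemitop 𝒪) (p : P)
    (hwr : WeaklyRegular 𝒪 p) :
    sClosure 𝒪 (community 𝒪 p) = intwSet 𝒪 p := by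
  ext q
  constructor
  · intro hq O hO O' hO' hpO hqO'
    obtain ⟨r, hrO', U, ⟨-, hU⟩, hrU⟩ := hq O' hO' hqO'
    exact hU hrU O hO O' hO' hpO hrO'
  · intro hq O hO hqO
    obtain ⟨U, ⟨hUo, hU⟩, hpU⟩ := hwr
    obtain ⟨r, hrU, hrO⟩ := hq U hUo O hO hpU hqO
    exact ⟨r, hrO, U, ⟨hUo, hU⟩, hrU⟩

end Semitop
end

section
/- Let (P, 𝒪) be a semitopology that is quasiregular (community(p) ≠ ∅ for every p ∈ P) and Hausdorff (for all distinct p, p' ∈ P there exist O, O' ∈ 𝒪 with p ∈ O, p' ∈ O' and O ∩ O' = ∅). Then (P, 𝒪) is discrete, i.e. 𝒪 is the full powerset of P. -/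
namespace Semitop

variable {P : Type*}

theorem quasiregular_hausdorff_discrete {P : Type*}
    (𝒪 : Set (Set P)) (hST : IsSemitop 𝒪)
    (hqr : ∀ p : P, (community 𝒪 p).Nonempty)
    (hHaus : ∀ p p' : P, p ≠ p' →
      ∃ O ∈ 𝒪, ∃ O' ∈ 𝒪, p ∈ O ∧ p' ∈ O' ∧ O ∩ O' = ∅) :
    𝒪 = Set.univ := by
  have intwSet_subset (p : P) : intwSet 𝒪 p ⊆ {p} := by
    intro q hq
    by_contra hne
    obtain ⟨O, hO, O', hO', hp, hq', hdisj⟩ := hHaus p q (Ne.symm hne)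
    exact (hq O hO O' hO' hp hq').ne_empty hdisj
  have singleton_mem (p : P) : {p} ∈ 𝒪 := by
    obtain ⟨x, O, ⟨hO, hsub⟩, hx⟩ := hqr p
    have hOp : O = {p} :=
      (Set.Nonempty.subset_singleton_iff ⟨x, hx⟩).mp (hsub.trans (intwSet_subset p))
    exact hOp ▸ hO
  refine Set.eq_univ_of_forall fun S => ?_
  have hS := hST.2.2 ((fun p => {p}) '' S) (by
    rintro _ ⟨p, -, rfl⟩
    exact singleton_mem p)
  simpa [Set.sUnion_image] using hS

end Semitop
end

section
/- Let (P, 𝒪) be a Hausdorff semitopology (any two distinct points have disjoint open neighbourhoods) and let p ∈ P be regular. Then {p} is clopen: {p} ∈ 𝒪 and {p} is closed. -/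
namespace Semitop

variable {P : Type*}

/-- In a Hausdorff semitopology, only `p` itself is intertwined with `p`. -/
theorem intwSet_eq_singleton {P : Type*} {𝒪 : Set (Set P)}
    (hHaus : ∀ p p' : P, p ≠ p' →
      ∃ O ∈ 𝒪, ∃ O' ∈ 𝒪, p ∈ O ∧ p' ∈ O' ∧ O ∩ O' = ∅) (p : P) :
    intwSet 𝒪 p = {p} := by
  ext q
  refine ⟨fun h => ?_, ?_⟩
  · by_contra hne
    obtain ⟨O, hO, O', hO', hp, hq, hd⟩ := hHaus p q (Ne.symm hne)
    exact (h O hO O' hO' hp hq).ne_empty hd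
  · rintro rfl O _ O' _ hp hp'
    exact ⟨q, hp, hp'⟩

/-- In a Hausdorff semitopology, singletons are closed. -/
theorem isClosedS_singleton {P : Type*} {𝒪 : Set (Set P)}
    (hHaus : ∀ p p' : P, p ≠ p' →
      ∃ O ∈ 𝒪, ∃ O' ∈ 𝒪, p ∈ O ∧ p' ∈ O' ∧ O ∩ O' = ∅) (p : P) :
    IsClosedS 𝒪 {p} := by
  ext q
  refine ⟨?_, fun h => ?_⟩
  · rintro rfl O _ hq
    exact ⟨q, hq, rfl⟩
  · by_contra hne
    obtain ⟨O, hO, O', _, hq, hp, hd⟩ := hHaus q p hne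
    obtain ⟨x, hx, rfl⟩ := h O hO hq
    exact Set.notMem_empty x (hd ▸ ⟨hx, hp⟩)

theorem hausdorff_regular_singleton_clopen {P : Type*}
    (𝒪 : Set (Set P)) (hST : IsSemitop 𝒪)
    (hHaus : ∀ p p' : P, p ≠ p' →
      ∃ O ∈ 𝒪, ∃ O' ∈ 𝒪, p ∈ O ∧ p' ∈ O' ∧ O ∩ O' = ∅)
    (p : P) (hreg : Regular 𝒪 p) :
    {p} ∈ 𝒪 ∧ IsClosedS 𝒪 {p} := by
  refine ⟨?_, isClosedS_singleton hHaus p⟩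
  obtain ⟨O, ⟨hO, hsub⟩, hp⟩ := hreg.1
  rw [intwSet_eq_singleton hHaus] at hsub
  rwa [← hsub.antisymm (Set.singleton_subset_iff.2 hp)]

end Semitop
end
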